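/- arXiv:2104.00665 — 3 statements merged into one kernel-verified Lean document; each statement's English description precedes it below -/
import Mathlib

section
/- Let a ≠ b be states of a finite irreducible reversible chain with P_π(τ_a < τ_b) ≤ 1/2. Then the expected number of visits to a before hitting b, started at a, satisfies E_a[N(a,τ_b)] ≤ 4·E_a[N(a, ⌊2 E_π[τ_a]⌋)], i.e. it is at most 4 times the expected number of visits to a during the first ⌊2 E_π[τ_a]⌋ steps. -/
open scoped BigOperators

/- `pathSum P x t A`: probability, for the chain with transition matrix `P` started
at `x`, of the event `A` about the first `t+1` positions of the trajectory. -/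
open Classical in
noncomputable def pathSum {V : Type*} [Fintype V] (P : V → V → ℝ) (x : V) (t : ℕ)
    (A : (Fin (t+1) → V) → Prop) : ℝ :=
  ∑ w : Fin (t+1) → V,
    if w 0 = x ∧ A w then ∏ i : Fin t, P (w i.castSucc) (w i.succ) else 0

/-- `P_x(τ_b > t)`: the chain started at `x` avoids `b` during the first `t` steps. -/
noncomputable def hitTail {V : Type*} [Fintype V] (P : V → V → ℝ) (x b : V) (t : ℕ) : ℝ :=
  pathSum P x t (fun w => ∀ i, w i ≠ b)

/-- `E_x[τ_b]`, the expected hitting time of `b` from `x`. -/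
noncomputable def hitExp {V : Type*} [Fintype V] (P : V → V → ℝ) (x b : V) : ℝ :=
  ∑' t : ℕ, hitTail P x b t

/-- `E_a[N(a,τ_b)]`: expected number of visits to `a` up to (and including) time `τ_b`,
for the chain started at `a`. -/
noncomputable def visitsBeforeExp {V : Type*} [Fintype V] (P : V → V → ℝ) (a b : V) : ℝ :=
  ∑' t : ℕ, pathSum P a t (fun w => w (Fin.last t) = a ∧ ∀ i, w i ≠ b)

/-- `E_a[N(a,s)]`: expected number of visits to `a` during the first `s` steps,
for the chain started at `a`. -/
noncomputable def visitsUpTo {V : Type*} [Fintype V] (P : V → V → ℝ) (a : V) (s : ℕ) : ℝ :=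
  ∑ t ∈ Finset.range (s+1), pathSum P a t (fun w => w (Fin.last t) = a)

/-- `P_x(τ_a < τ_b)`: the chain started at `x` hits `a` strictly before `b`. -/
noncomputable def hitBeforeProb {V : Type*} [Fintype V] (P : V → V → ℝ) (x a b : V) : ℝ :=
  ∑' t : ℕ, pathSum P x t
    (fun w => w (Fin.last t) = a ∧ ∀ i, i ≠ Fin.last t → (w i ≠ a ∧ w i ≠ b))


section Helpers
variable {V : Type*} [Fintype V]

theorem pathSum_zero' (P : V → V → ℝ) (x : V) (A : (Fin 1 → V) → Prop) [Decidable (A fun _ => x)] :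
    pathSum P x 0 A = if A (fun _ => x) then 1 else 0 := by
  classical
  unfold pathSum
  rw [Finset.sum_eq_single (fun _ => x)]
  · simp
  · intro w _ hw
    rw [if_neg]
    rintro ⟨h, -⟩
    apply hw
    funext i
    have hi : i = 0 := Fin.ext (by omega)
    rw [hi, h]
  · simp

theorem pathSum_succ' (P : V → V → ℝ) (x : V) (t : ℕ) (A : (Fin (t+1+1) → V) → Prop) :
    pathSum P x (t+1) A
      = ∑ y, P x y * pathSum P y t (fun w => A (Fin.cons x w)) := by
  classical
  unfold pathSum
  rw [← (Fin.consEquiv (fun _ : Fin (t+1+1) => V)).sum_comp, Fintype.sum_prod_type]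
  rw [Finset.sum_eq_single x]
  · simp_rw [Finset.mul_sum]
    rw [Finset.sum_comm]
    refine Finset.sum_congr rfl fun w _ => ?_
    rw [Finset.sum_eq_single (w 0)]
    · simp [Fin.consEquiv, Fin.prod_univ_succ]
    · intro y _ hy
      rw [if_neg, mul_zero]
      rintro ⟨h, -⟩
      exact hy h.symm
    · simp
  · intro y _ hy
    refine Finset.sum_eq_zero fun w _ => ?_
    rw [if_neg]
    rintro ⟨h, -⟩
    exact hy h
  · simp

theorem pathSum_congr' (P : V → V → ℝ) (x : V) (t : ℕ) {A B : (Fin (t+1) → V) → Prop}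
    (h : ∀ w, A w ↔ B w) : pathSum P x t A = pathSum P x t B := by
  have : A = B := funext fun w => propext (h w)
  rw [this]

theorem pathSum_false' (P : V → V → ℝ) (x : V) (t : ℕ) {A : (Fin (t+1) → V) → Prop}
    (h : ∀ w, ¬ A w) : pathSum P x t A = 0 := by
  unfold pathSum
  exact Finset.sum_eq_zero fun w _ => if_neg fun hh => h w hh.2

/-- transition operator -/
noncomputable def opL (P : V → V → ℝ) : (V → ℝ) →ₗ[ℝ] (V → ℝ) := Matrix.mulVecLin (Matrix.of P)

theorem opL_apply (P : V → V → ℝ) (f : V → ℝ) (x : V) : opL P f x = ∑ y, P x y * f y := by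
  simp [opL, Matrix.mulVec, dotProduct]

theorem opL_mono (P : V → V → ℝ) (hnn : ∀ x y, 0 ≤ P x y) {f g : V → ℝ} (h : ∀ x, f x ≤ g x) (x : V) :
    opL P f x ≤ opL P g x := by
  rw [opL_apply, opL_apply]
  exact Finset.sum_le_sum fun y _ => mul_le_mul_of_nonneg_left (h y) (hnn x y)

theorem opL_pow_mono (P : V → V → ℝ) (hnn : ∀ x y, 0 ≤ P x y) (n : ℕ) {f g : V → ℝ}
    (h : ∀ x, f x ≤ g x) (x : V) : (opL P ^ n) f x ≤ (opL P ^ n) g x := by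
  induction n generalizing x with
  | zero => simpa using h x
  | succ n ih =>
    rw [pow_succ', Module.End.mul_apply, Module.End.mul_apply]
    exact opL_mono P hnn ih x

theorem opL_const (P : V → V → ℝ) (hrow : ∀ x, ∑ y, P x y = 1) (c : ℝ) (x : V) :
    opL P (fun _ => c) x = c := by
  rw [opL_apply, ← Finset.sum_mul, hrow, one_mul]

theorem opL_nonneg (P : V → V → ℝ) (hnn : ∀ x y, 0 ≤ P x y) {f : V → ℝ} (h : ∀ x, 0 ≤ f x) (x : V) :
    0 ≤ opL P f x := by
  rw [opL_apply]
  exact Finset.sum_nonneg fun y _ => mul_nonneg (hnn x y) (h y)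

/-- weighted inner product -/
noncomputable def ipW (π : V → ℝ) (f g : V → ℝ) : ℝ := ∑ x, π x * (f x * g x)

theorem ipW_comm (π f g : V → ℝ) : ipW π f g = ipW π g f := by
  unfold ipW; exact Finset.sum_congr rfl fun x _ => by ring
theorem ipW_sub_left (π f g h : V → ℝ) : ipW π (f - g) h = ipW π f h - ipW π g h := by
  unfold ipW; rw [← Finset.sum_sub_distrib]
  exact Finset.sum_congr rfl fun x _ => by simp only [Pi.sub_apply]; ring
theorem ipW_sub_right (π f g h : V → ℝ) : ipW π h (f - g) = ipW π h f - ipW π h g := by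
  rw [ipW_comm, ipW_sub_left, ipW_comm π f, ipW_comm π g]
theorem ipW_add_left (π f g h : V → ℝ) : ipW π (f + g) h = ipW π f h + ipW π g h := by
  unfold ipW; rw [← Finset.sum_add_distrib]
  exact Finset.sum_congr rfl fun x _ => by simp only [Pi.add_apply]; ring
theorem ipW_add_right (π f g h : V → ℝ) : ipW π h (f + g) = ipW π h f + ipW π h g := by
  rw [ipW_comm, ipW_add_left, ipW_comm π f, ipW_comm π g]
theorem ipW_self_nonneg (π f : V → ℝ) (hπ0 : ∀ x, 0 < π x) : 0 ≤ ipW π f f :=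
  Finset.sum_nonneg fun x _ => mul_nonneg (hπ0 x).le (mul_self_nonneg _)

theorem ipW_opL (P : V → V → ℝ) (π : V → ℝ) (hrev : ∀ x y, π x * P x y = π y * P y x)
    (f g : V → ℝ) : ipW π (opL P f) g = ipW π f (opL P g) := by
  unfold ipW
  simp_rw [opL_apply, Finset.sum_mul, Finset.mul_sum]
  rw [Finset.sum_comm]
  refine Finset.sum_congr rfl fun x _ => Finset.sum_congr rfl fun y _ => ?_
  linear_combination (f x * g y) * hrev y x

theorem ipW_opL_pow (P : V → V → ℝ) (π : V → ℝ) (hrev : ∀ x y, π x * P x y = π y * P y x)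
    (n : ℕ) (f g : V → ℝ) : ipW π ((opL P ^ n) f) g = ipW π f ((opL P ^ n) g) := by
  induction n generalizing f g with
  | zero => simp
  | succ n ih =>
    rw [pow_succ', Module.End.mul_apply, ipW_opL P π hrev, ih, ← Module.End.mul_apply, ← pow_succ,
      ← pow_succ']

theorem ipW_contr (P : V → V → ℝ) (π : V → ℝ)
    (hnn : ∀ x y, 0 ≤ P x y) (hrow : ∀ x, ∑ y, P x y = 1) (hπ0 : ∀ x, 0 < π x)
    (hrev : ∀ x y, π x * P x y = π y * P y x)
    (f : V → ℝ) : ipW π (opL P f) (opL P f) ≤ ipW π f f := by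
  have h1 : ipW π f f = ipW π (opL P (fun x => f x * f x)) (fun _ => 1) := by
    rw [ipW_opL P π hrev]
    unfold ipW
    simp_rw [opL_const P hrow, mul_one]
  rw [h1]
  unfold ipW
  refine Finset.sum_le_sum fun x _ => mul_le_mul_of_nonneg_left ?_ (hπ0 x).le
  set m := opL P f x with hm
  have h2 : 0 ≤ ∑ y, P x y * (f y - m)^2 :=
    Finset.sum_nonneg fun y _ => mul_nonneg (hnn x y) (sq_nonneg _)
  have h3 : ∑ y, P x y * (f y - m)^2
      = opL P (fun x => f x * f x) x - 2 * m * opL P f x + m^2 * ∑ y, P x y := by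
    rw [opL_apply, opL_apply, Finset.mul_sum, Finset.mul_sum, ← Finset.sum_sub_distrib,
      ← Finset.sum_add_distrib]
    exact Finset.sum_congr rfl fun y _ => by ring
  rw [hrow, ← hm] at h3
  nlinarith

/-- spectral-type estimate -/
theorem key_spectral (P : V → V → ℝ) (π : V → ℝ)
    (hnn : ∀ x y, 0 ≤ P x y) (hrow : ∀ x, ∑ y, P x y = 1) (hπ0 : ∀ x, 0 < π x)
    (hrev : ∀ x y, π x * P x y = π y * P y x) (φ : V → ℝ) (s : ℕ) :
    ((s:ℝ)+1) * ipW π ((opL P ^ s) (φ - opL P (opL P φ))) ((opL P ^ s) (φ - opL P (opL P φ)))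
      ≤ 2 * ipW π φ (φ - opL P φ) := by
  set L := opL P with hL
  set d : ℕ → ℝ := fun t => ipW π ((L ^ t) (φ - L (L φ))) ((L ^ t) (φ - L (L φ))) with hd
  have hanti : Antitone d := antitone_nat_of_succ_le fun t => by
    simp only [hd]
    rw [pow_succ', Module.End.mul_apply]
    exact ipW_contr P π hnn hrow hπ0 hrev _
  set e : ℕ → ℝ := fun t => ipW π ((L^t) φ) ((L^t) φ) with he
  have he1 : ∀ t, e (t+1) ≤ e t := fun t => by
    simp only [he]
    rw [pow_succ', Module.End.mul_apply]
    exact ipW_contr P π hnn hrow hπ0 hrev _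
  have hdt : ∀ t, d t = (e t - e (t+1)) - (e (t+1) - e (t+2)) := fun t => by
    simp only [hd, he]
    have e1 : (L^(t+1)) φ = L ((L^t) φ) := by rw [pow_succ', Module.End.mul_apply]
    have e2 : (L^(t+2)) φ = L (L ((L^t) φ)) := by
      rw [pow_succ', Module.End.mul_apply, e1]
    have e3 : (L^t) (L (L φ)) = L (L ((L^t) φ)) := by
      rw [← e2, pow_add, Module.End.mul_apply, pow_two, Module.End.mul_apply]
    rw [map_sub, e3, e1, e2]
    set ψ := (L^t) φ
    have k1 : ipW π ψ (L (L ψ)) = ipW π (L ψ) (L ψ) := (ipW_opL P π hrev _ _).symm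
    have k2 : ipW π (L (L ψ)) ψ = ipW π (L ψ) (L ψ) := ipW_opL P π hrev _ _
    rw [ipW_sub_left, ipW_sub_right, ipW_sub_right, k1, k2]
  have hsum : ∀ n : ℕ, ∑ t ∈ Finset.range n, d t = (e 0 - e 1) - (e n - e (n+1)) := fun n => by
    induction n with
    | zero => simp
    | succ n ih => rw [Finset.sum_range_succ, ih, hdt]; ring
  have h1 : ((s:ℝ)+1) * d s ≤ ∑ t ∈ Finset.range (s+1), d t := by
    have := Finset.card_nsmul_le_sum (Finset.range (s+1)) d (d s)
      (fun t ht => hanti (by have := Finset.mem_range.1 ht; omega))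
    simpa using this
  have h2 : e 0 - e 1 ≤ 2 * ipW π φ (φ - L φ) := by
    have := ipW_self_nonneg π (φ - L φ) hπ0
    simp only [he, pow_zero, pow_one, Module.End.one_apply]
    rw [ipW_sub_left, ipW_sub_right, ipW_sub_right, ipW_comm π (L φ) φ] at this
    rw [ipW_sub_right]
    linarith
  have := he1 (s+1)
  have := hsum (s+1)
  linarith

end Helpers

section Helpers2
variable {V : Type*} [Fintype V] [DecidableEq V]

theorem visit_eq (P : V → V → ℝ) (a x : V) (t : ℕ) :
    pathSum P x t (fun w => w (Fin.last t) = a) = (opL P ^ t) (Pi.single a 1) x := by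
  induction t generalizing x with
  | zero =>
    rw [pathSum_zero']
    simp [Pi.single_apply]
  | succ t ih =>
    rw [pathSum_succ', pow_succ', Module.End.mul_apply, opL_apply]
    refine Finset.sum_congr rfl fun y _ => ?_
    rw [← ih]
    congr 1

theorem hitTail_zero' (P : V → V → ℝ) (x a : V) : hitTail P x a 0 = if x = a then 0 else 1 := by
  unfold hitTail
  rw [pathSum_zero']
  simp only [ne_eq, forall_const]
  split_ifs <;> simp_all

theorem hitTail_succ' (P : V → V → ℝ) (x a : V) (t : ℕ) :
    hitTail P x a (t+1) = if x = a then 0 else opL P (fun y => hitTail P y a t) x := by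
  unfold hitTail
  split_ifs with h
  · rw [pathSum_succ']
    refine Finset.sum_eq_zero fun y _ => ?_
    rw [pathSum_false', mul_zero]
    intro w hw
    exact hw 0 (by simpa using h)
  · rw [pathSum_succ', opL_apply]
    refine Finset.sum_congr rfl fun y _ => ?_
    congr 1
    refine pathSum_congr' P y t fun w => ?_
    rw [Fin.forall_fin_succ]
    simp [h]

/-- killed visits -/
noncomputable def kVis (P : V → V → ℝ) (a b : V) (t : ℕ) (x : V) : ℝ :=
  pathSum P x t (fun w => w (Fin.last t) = a ∧ ∀ i, w i ≠ b)

theorem kVis_zero (P : V → V → ℝ) (a b : V) (hab : a ≠ b) (x : V) :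
    kVis P a b 0 x = if x = a then 1 else 0 := by
  unfold kVis
  rw [pathSum_zero']
  simp only [ne_eq, forall_const]
  congr 1
  simp only [eq_iff_iff, and_iff_left_iff_imp]
  rintro rfl
  exact hab

theorem kVis_succ (P : V → V → ℝ) (a b : V) (x : V) (t : ℕ) :
    kVis P a b (t+1) x = if x = b then 0 else opL P (kVis P a b t) x := by
  split_ifs with h
  · unfold kVis
    rw [pathSum_succ']
    refine Finset.sum_eq_zero fun y _ => ?_
    rw [pathSum_false', mul_zero]
    rintro w ⟨-, hw⟩
    exact hw 0 (by simpa using h)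
  · rw [opL_apply]
    unfold kVis
    rw [pathSum_succ']
    refine Finset.sum_congr rfl fun y _ => ?_
    congr 1
    refine pathSum_congr' P y t fun w => ?_
    rw [Fin.forall_fin_succ, ← Fin.succ_last]
    simp [h]

/-- hit `a` before `b` at time `t` -/
noncomputable def kHit (P : V → V → ℝ) (a b : V) (t : ℕ) (x : V) : ℝ :=
  pathSum P x t (fun w => w (Fin.last t) = a ∧ ∀ i, i ≠ Fin.last t → (w i ≠ a ∧ w i ≠ b))

theorem kHit_zero (P : V → V → ℝ) (a b : V) (x : V) :
    kHit P a b 0 x = if x = a then 1 else 0 := by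
  unfold kHit
  rw [pathSum_zero']
  congr 1
  simp only [eq_iff_iff, and_iff_left_iff_imp]
  intro _ i hi
  exact absurd (Fin.ext (by omega)) hi

theorem kHit_succ (P : V → V → ℝ) (a b : V) (x : V) (t : ℕ) :
    kHit P a b (t+1) x = if x = a ∨ x = b then 0 else opL P (kHit P a b t) x := by
  split_ifs with h
  · unfold kHit
    rw [pathSum_succ']
    refine Finset.sum_eq_zero fun y _ => ?_
    rw [pathSum_false', mul_zero]
    rintro w ⟨-, hw⟩
    have := hw 0 (by simp [Fin.ext_iff])
    simp only [Fin.cons_zero] at this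
    tauto
  · rw [opL_apply]
    unfold kHit
    rw [pathSum_succ']
    refine Finset.sum_congr rfl fun y _ => ?_
    congr 1
    refine pathSum_congr' P y t fun w => ?_
    push Not at h
    rw [Fin.forall_fin_succ, ← Fin.succ_last]
    simp [h]

variable (P : V → V → ℝ)

theorem opL_sum (f : ℕ → V → ℝ) (n : ℕ) (x : V) :
    opL P (fun y => ∑ t ∈ Finset.range n, f t y) x = ∑ t ∈ Finset.range n, opL P (f t) x := by
  simp_rw [opL_apply, Finset.mul_sum]
  rw [Finset.sum_comm]

theorem kVis_nonneg (hnn : ∀ x y, 0 ≤ P x y) (a b : V) (t : ℕ) (x : V) : 0 ≤ kVis P a b t x := by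
  unfold kVis pathSum
  refine Finset.sum_nonneg fun w _ => ?_
  split_ifs
  · exact Finset.prod_nonneg fun i _ => hnn _ _
  · rfl

theorem kHit_nonneg (hnn : ∀ x y, 0 ≤ P x y) (a b : V) (t : ℕ) (x : V) : 0 ≤ kHit P a b t x := by
  unfold kHit pathSum
  refine Finset.sum_nonneg fun w _ => ?_
  split_ifs
  · exact Finset.prod_nonneg fun i _ => hnn _ _
  · rfl

theorem hitTail_nonneg (hnn : ∀ x y, 0 ≤ P x y) (a : V) (t : ℕ) (x : V) : 0 ≤ hitTail P x a t := by
  unfold hitTail pathSum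
  refine Finset.sum_nonneg fun w _ => ?_
  split_ifs
  · exact Finset.prod_nonneg fun i _ => hnn _ _
  · rfl

/-- partial sums -/
noncomputable def sVis (P : V → V → ℝ) (a b : V) (n : ℕ) (x : V) : ℝ :=
  ∑ t ∈ Finset.range n, kVis P a b t x
noncomputable def sHit (P : V → V → ℝ) (a b : V) (n : ℕ) (x : V) : ℝ :=
  ∑ t ∈ Finset.range n, kHit P a b t x
noncomputable def sTail (P : V → V → ℝ) (a : V) (n : ℕ) (x : V) : ℝ :=
  ∑ t ∈ Finset.range n, hitTail P x a t

theorem sVis_succ (a b : V) (hab : a ≠ b) (n : ℕ) (x : V) :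
    sVis P a b (n+1) x = (if x = a then 1 else 0) + if x = b then 0 else opL P (sVis P a b n) x := by
  have : opL P (sVis P a b n) x = ∑ t ∈ Finset.range n, opL P (kVis P a b t) x := opL_sum P _ n x
  rw [this]
  unfold sVis
  rw [Finset.sum_range_succ', kVis_zero P a b hab, add_comm]
  simp_rw [kVis_succ]
  split_ifs <;> simp

theorem sHit_succ (a b : V) (n : ℕ) (x : V) :
    sHit P a b (n+1) x
      = (if x = a then 1 else 0) + if x = a ∨ x = b then 0 else opL P (sHit P a b n) x := by
  have : opL P (sHit P a b n) x = ∑ t ∈ Finset.range n, opL P (kHit P a b t) x := opL_sum P _ n x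
  rw [this]
  unfold sHit
  rw [Finset.sum_range_succ', kHit_zero P a b, add_comm]
  simp_rw [kHit_succ]
  congr 1
  split_ifs <;> simp

theorem sTail_succ (a : V) (n : ℕ) (x : V) :
    sTail P a (n+1) x = if x = a then 0 else 1 + opL P (sTail P a n) x := by
  have : opL P (sTail P a n) x = ∑ t ∈ Finset.range n, opL P (fun y => hitTail P y a t) x :=
    opL_sum P (fun t y => hitTail P y a t) n x
  rw [this]
  unfold sTail
  rw [Finset.sum_range_succ', hitTail_zero' P, add_comm]
  simp_rw [hitTail_succ']
  split_ifs <;> simp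

theorem sVis_mono (hnn : ∀ x y, 0 ≤ P x y) (a b : V) (x : V) : Monotone fun n => sVis P a b n x :=
  monotone_nat_of_le_succ fun n => by
    unfold sVis
    rw [Finset.sum_range_succ]
    linarith [kVis_nonneg P hnn a b n x]
theorem sTail_mono (hnn : ∀ x y, 0 ≤ P x y) (a : V) (x : V) : Monotone fun n => sTail P a n x :=
  monotone_nat_of_le_succ fun n => by
    unfold sTail
    rw [Finset.sum_range_succ]
    linarith [hitTail_nonneg P hnn a n x]
theorem sVis_nonneg (hnn : ∀ x y, 0 ≤ P x y) (a b : V) (n : ℕ) (x : V) : 0 ≤ sVis P a b n x :=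
  Finset.sum_nonneg fun t _ => kVis_nonneg P hnn a b t x
theorem sTail_nonneg (hnn : ∀ x y, 0 ≤ P x y) (a : V) (n : ℕ) (x : V) : 0 ≤ sTail P a n x :=
  Finset.sum_nonneg fun t _ => hitTail_nonneg P hnn a t x

theorem sHit_le_one (hnn : ∀ x y, 0 ≤ P x y) (hrow : ∀ x, ∑ y, P x y = 1) (a b : V) (n : ℕ) (x : V) :
    sHit P a b n x ≤ 1 := by
  induction n generalizing x with
  | zero => simp [sHit]
  | succ n ih =>
    rw [sHit_succ]
    have h := opL_mono P hnn ih x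
    rw [opL_const P hrow] at h
    split_ifs with h1 h2 <;> simp_all

theorem kHit_summable (hnn : ∀ x y, 0 ≤ P x y) (hrow : ∀ x, ∑ y, P x y = 1) (a b : V) (x : V) :
    Summable fun t => kHit P a b t x :=
  summable_of_sum_range_le (fun t => kHit_nonneg P hnn a b t x)
    (fun n => sHit_le_one P hnn hrow a b n x)

theorem hitBefore_le_one (hnn : ∀ x y, 0 ≤ P x y) (hrow : ∀ x, ∑ y, P x y = 1) (a b : V) (x : V) :
    hitBeforeProb P x a b ≤ 1 :=
  Real.tsum_le_of_sum_range_le (fun t => kHit_nonneg P hnn a b t x)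
    (fun n => sHit_le_one P hnn hrow a b n x)

theorem hitBefore_nonneg (hnn : ∀ x y, 0 ≤ P x y) (a b : V) (x : V) :
    0 ≤ hitBeforeProb P x a b := tsum_nonneg fun t => kHit_nonneg P hnn a b t x

theorem sHit_le_hitBefore (hnn : ∀ x y, 0 ≤ P x y) (hrow : ∀ x, ∑ y, P x y = 1) (a b : V)
    (n : ℕ) (x : V) : sHit P a b n x ≤ hitBeforeProb P x a b :=
  (kHit_summable P hnn hrow a b x).sum_le_tsum _ (fun t _ => kHit_nonneg P hnn a b t x)

theorem sVis_le (hnn : ∀ x y, 0 ≤ P x y) (a b : V) (hab : a ≠ b)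
    (n : ℕ) (x : V) : sVis P a b n x ≤ sHit P a b n x * sVis P a b n a := by
  induction n generalizing x with
  | zero => simp [sVis]
  | succ n ih =>
    by_cases hxa : x = a
    · subst hxa
      rw [sHit_succ]; simp
    by_cases hxb : x = b
    · subst hxb
      rw [sVis_succ P _ _ hab, sHit_succ]; simp [hxa]
    rw [sVis_succ P _ _ hab n x, sHit_succ P a b n x]
    simp only [hxa, hxb, or_self, if_false, zero_add]
    have h1 := opL_mono P hnn (g := fun x => sHit P a b n x * sVis P a b (n+1) a) (fun y =>
      (ih y).trans (mul_le_mul_of_nonneg_left (sVis_mono P hnn a b a n.le_succ)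
        (Finset.sum_nonneg fun t _ => kHit_nonneg P hnn a b t y))) x
    refine h1.trans (le_of_eq ?_)
    rw [opL_apply, opL_apply, Finset.sum_mul]
    exact Finset.sum_congr rfl fun y _ => by ring

theorem sVis_shift (hnn : ∀ x y, 0 ≤ P x y) (a b : V) (hab : a ≠ b)
    (n t : ℕ) (x : V) : sVis P a b (n+t) x
      ≤ ∑ i ∈ Finset.range t, (opL P ^ i) (Pi.single a 1) x + (opL P ^ t) (sVis P a b n) x := by
  induction t generalizing x with
  | zero => simp
  | succ t ih =>
    rw [← add_assoc, sVis_succ P a b hab]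
    have h0 : 0 ≤ opL P (sVis P a b (n+t)) x :=
      opL_nonneg P hnn (sVis_nonneg P hnn a b (n+t)) x
    have h1 := opL_mono P hnn ih x
    have h2 : opL P (fun x => ∑ i ∈ Finset.range t, (opL P ^ i) (Pi.single a 1) x
        + (opL P ^ t) (sVis P a b n) x) x
        = ∑ i ∈ Finset.range t, (opL P ^ (i+1)) (Pi.single a 1) x
          + (opL P ^ (t+1)) (sVis P a b n) x := by
      simp_rw [pow_succ', Module.End.mul_apply]
      rw [← opL_sum P (fun i => (opL P ^ i) (Pi.single a 1)) t x]
      rw [← Pi.add_apply, ← map_add]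
      rfl
    rw [Finset.sum_range_succ', pow_zero, Module.End.one_apply, Pi.single_apply]
    have h3 : (if x = b then 0 else opL P (sVis P a b (n+t)) x) ≤ opL P (sVis P a b (n+t)) x := by
      split_ifs
      · exact h0
      · rfl
    linarith

theorem sVis_bound (hnn : ∀ x y, 0 ≤ P x y) (hrow : ∀ x, ∑ y, P x y = 1) (a b : V) (hab : a ≠ b)
    (n t : ℕ) : sVis P a b n a
      ≤ ∑ i ∈ Finset.range t, (opL P ^ i) (Pi.single a 1) a
        + sVis P a b n a * (opL P ^ t) (fun x => hitBeforeProb P x a b) a := by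
  have h1 := sVis_shift P hnn a b hab n t a
  have h2 := sVis_mono P hnn a b a (Nat.le_add_right n t)
  have h3 := opL_pow_mono P hnn t (f := sVis P a b n)
    (g := sVis P a b n a • (fun x => hitBeforeProb P x a b)) (fun x => by
      refine (sVis_le P hnn a b hab n x).trans ?_
      rw [mul_comm]
      exact mul_le_mul_of_nonneg_left (sHit_le_hitBefore P hnn hrow a b n x)
        (sVis_nonneg P hnn a b n a)) a
  rw [map_smul, Pi.smul_apply, smul_eq_mul] at h3
  dsimp only at h2
  linarith

theorem stat_opL (π : V → ℝ) (hrow : ∀ x, ∑ y, P x y = 1)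
    (hrev : ∀ x y, π x * P x y = π y * P y x) (f : V → ℝ) :
    ∑ x, π x * opL P f x = ∑ x, π x * f x := by
  have h := ipW_opL P π hrev f (fun _ => 1)
  unfold ipW at h
  simp_rw [opL_const P hrow, mul_one] at h
  exact h

theorem sTail_bdd (π : V → ℝ) (hnn : ∀ x y, 0 ≤ P x y) (hrow : ∀ x, ∑ y, P x y = 1)
    (hirr : ∀ x y, ∃ n : ℕ, 0 < (Matrix.of P ^ n) x y)
    (hπ0 : ∀ x, 0 < π x) 
    (hrev : ∀ x y, π x * P x y = π y * P y x) (a y : V) :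
    ∃ C, ∀ n, sTail P a n y ≤ C := by
  -- bound on `L G_n` at every good point
  have hLa : ∃ C, ∀ n, opL P (sTail P a n) a ≤ C := by
    refine ⟨(∑ x, π x) / π a, fun n => ?_⟩
    rw [le_div_iff₀ (hπ0 a)]
    have h1 : ∑ x, π x * sTail P a n x ≤ ∑ x, π x * sTail P a (n+1) x :=
      Finset.sum_le_sum fun x _ =>
        mul_le_mul_of_nonneg_left (sTail_mono P hnn a x n.le_succ) (hπ0 x).le
    have h2 : ∑ x, π x * sTail P a (n+1) x
        ≤ ∑ x, (π x + π x * opL P (sTail P a n) x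
            - if x = a then π a * opL P (sTail P a n) a else 0) := by
      refine Finset.sum_le_sum fun x _ => ?_
      rw [sTail_succ]
      split_ifs with h
      · subst h; linarith [hπ0 x]
      · linarith
    rw [Finset.sum_sub_distrib, Finset.sum_add_distrib, stat_opL P π hrow hrev,
      Finset.sum_ite_eq' Finset.univ a] at h2
    simp only [Finset.mem_univ, if_true] at h2
    linarith
  have hstep : ∀ x y, (∃ C, ∀ n, sTail P a n x ≤ C) → 0 < P x y → ∃ C, ∀ n, sTail P a n y ≤ C := by
    intro x y hx hxy
    have hL : ∃ C, ∀ n, opL P (sTail P a n) x ≤ C := by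
      by_cases h : x = a
      · rw [h]; exact hLa
      · obtain ⟨C, hC⟩ := hx
        refine ⟨C, fun n => ?_⟩
        have := hC (n+1)
        rw [sTail_succ, if_neg h] at this
        linarith
    obtain ⟨C, hC⟩ := hL
    refine ⟨C / P x y, fun n => ?_⟩
    rw [le_div_iff₀ hxy, mul_comm]
    refine le_trans ?_ (hC n)
    rw [opL_apply]
    exact Finset.single_le_sum (f := fun y => P x y * sTail P a n y)
      (fun z _ => mul_nonneg (hnn x z) (sTail_nonneg P hnn a n z)) (Finset.mem_univ y)
  have hpow : ∀ n : ℕ, ∀ y, (Matrix.of P ^ n) a y ≠ 0 → ∃ C, ∀ n, sTail P a n y ≤ C := by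
    intro n
    induction n with
    | zero =>
      intro y hy
      have : a = y := by
        by_contra h
        exact hy (by simp [Matrix.one_apply, h])
      subst this
      refine ⟨0, fun n => ?_⟩
      cases n with
      | zero => simp [sTail]
      | succ n => rw [sTail_succ]; simp
    | succ n ih =>
      intro y hy
      rw [pow_succ, Matrix.mul_apply] at hy
      obtain ⟨z, -, hz⟩ := Finset.exists_ne_zero_of_sum_ne_zero hy
      have hz1 := left_ne_zero_of_mul hz
      have hz2 : P z y ≠ 0 := right_ne_zero_of_mul hz
      exact hstep z y (ih z hz1) (lt_of_le_of_ne (hnn z y) hz2.symm)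
  obtain ⟨n, hn⟩ := hirr a y
  exact hpow n y hn.ne'

theorem hitExp_eq (π : V → ℝ) (hnn : ∀ x y, 0 ≤ P x y) (hrow : ∀ x, ∑ y, P x y = 1)
    (hirr : ∀ x y, ∃ n : ℕ, 0 < (Matrix.of P ^ n) x y)
    (hπ0 : ∀ x, 0 < π x) 
    (hrev : ∀ x y, π x * P x y = π y * P y x) (a x : V) :
    hitExp P x a = if x = a then 0 else 1 + opL P (fun y => hitExp P y a) x := by
  have hs : ∀ y, Summable fun t => hitTail P y a t := fun y => by
    obtain ⟨C, hC⟩ := sTail_bdd P π hnn hrow hirr hπ0 hrev a y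
    exact summable_of_sum_range_le (fun t => hitTail_nonneg P hnn a t y) hC
  rw [opL_apply]
  unfold hitExp
  rw [(hs x).tsum_eq_zero_add, hitTail_zero']
  simp_rw [hitTail_succ']
  split_ifs with h
  · simp
  · congr 1
    simp_rw [opL_apply, ← tsum_mul_left]
    rw [Summable.tsum_finsetSum]
    exact fun y _ => (hs y).mul_left _

end Helpers2

/-- If `a ≠ b` and `P_π(τ_a < τ_b) ≤ 1/2` then
`E_a[N(a,τ_b)] ≤ 4·E_a[N(a, ⌊2 E_π[τ_a]⌋)]`. -/
theorem visitsBefore_le_visitsUpTo {V : Type*} [Fintype V] [DecidableEq V]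
    (P : V → V → ℝ) (π : V → ℝ)
    (hnn : ∀ x y, 0 ≤ P x y) (hrow : ∀ x, ∑ y, P x y = 1)
    (hirr : ∀ x y, ∃ n : ℕ, 0 < (Matrix.of P ^ n) x y)
    (hπ0 : ∀ x, 0 < π x) (hπ1 : ∑ x, π x = 1)
    (hrev : ∀ x y, π x * P x y = π y * P y x)
    (a b : V) (hab : a ≠ b)
    (hhalf : ∑ x, π x * hitBeforeProb P x a b ≤ 1 / 2) :
    visitsBeforeExp P a b
      ≤ 4 * visitsUpTo P a ⌊2 * ∑ x, π x * hitExp P x a⌋₊ := by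
  set E := ∑ x, π x * hitExp P x a with hE
  set s := ⌊2 * E⌋₊ with hs
  set L := opL P with hL
  set h : V → ℝ := fun x => hitBeforeProb P x a b with hh
  have hTeq := hitExp_eq P π hnn hrow hirr hπ0 hrev a
  set T : V → ℝ := fun x => hitExp P x a with hT
  -- Poisson equation
  have hTa : T a = 0 := by simp [hT, hTeq a]
  have hTx : ∀ x, x ≠ a → T x = 1 + L T x := fun x hx => by
    have := hTeq x
    rwa [if_neg hx] at this
  have hLTa : π a * L T a = 1 - π a := by
    have h1 := stat_opL P π hrow hrev T
    have h2 : ∀ x, π x * T x - π x * L T x = π x - if x = a then π a + π a * L T a else 0 := by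
      intro x
      split_ifs with hx
      · rw [hx, hTa]; ring
      · rw [hTx x hx]; ring
    have h3 := Finset.sum_congr rfl fun x (_ : x ∈ Finset.univ) => h2 x
    rw [Finset.sum_sub_distrib, Finset.sum_sub_distrib, h1, Finset.sum_ite_eq' Finset.univ a,
      hπ1] at h3
    simp only [Finset.mem_univ, if_true] at h3
    linarith
  set k : V → ℝ := Pi.single a (π a)⁻¹ with hk
  set φ : V → ℝ := -T with hφ
  have hφk : φ - L φ = k - (fun _ => 1) := by
    funext x
    rw [hφ, map_neg]
    simp only [Pi.sub_apply, Pi.neg_apply, hk, Pi.single_apply]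
    split_ifs with hx
    · rw [hx, hTa]
      have := (hπ0 a).ne'
      field_simp
      linarith
    · rw [hTx x hx]; ring
  have hipk : ∀ f : V → ℝ, ipW π k f = f a := fun f => by
    unfold ipW
    rw [Finset.sum_eq_single a]
    · have := (hπ0 a).ne'
      simp only [hk, Pi.single_eq_same]
      field_simp
    · intro x _ hx
      simp [hk, Pi.single_eq_of_ne hx]
    · simp
  have hip1 : ∀ f : V → ℝ, ipW π (fun _ => 1) f = ∑ x, π x * f x := fun f => by
    unfold ipW; simp
  have hEip : ipW π φ (φ - L φ) = E := by
    rw [hφk, ipW_comm, ipW_sub_left, hipk, hip1, hφ]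
    have hTa2 : hitExp P a a = 0 := hTa
    simp [hTa2, hE, hT]
  have hkey := key_spectral P π hnn hrow hπ0 hrev φ s
  rw [← hL, hEip] at hkey
  set D := (L ^ s) (φ - L (L φ)) with hD
  have hfl : 2 * E < s + 1 := Nat.lt_floor_add_one _
  have hDD : ipW π D D ≤ 1 := by
    by_contra hc
    push Not at hc
    have : (0:ℝ) < (s:ℝ) + 1 := by positivity
    nlinarith
  -- relation of D to h
  have hDh : ∀ f : V → ℝ, ipW π D f = (L^s) f a + (L^(s+1)) f a - 2 * ∑ x, π x * f x := fun f => by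
    have e1 : φ - L (L φ) = (k - (fun _ => 1)) + L (k - (fun _ => 1)) := by
      rw [← hφk, map_sub]; abel
    have st : ∀ n : ℕ, ∑ x, π x * (L^n) f x = ∑ x, π x * f x := fun n => by
      induction n with
      | zero => simp
      | succ n ih => rw [pow_succ', ← ih]; exact stat_opL P π hrow hrev _
    rw [hD, e1, ipW_opL_pow P π hrev, ipW_add_left, ipW_opL P π hrev, ← Module.End.mul_apply,
      ← pow_succ', ipW_sub_left, ipW_sub_left, hipk, hipk, hip1, hip1, st, st]
    ring
  have hL1 : ∀ n : ℕ, (L^n) (fun _ => 1) a = 1 := fun n => by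
    have : (L^n) (fun _ => (1:ℝ)) = fun _ => 1 := by
      induction n with
      | zero => simp
      | succ n ih =>
        rw [pow_succ', Module.End.mul_apply, ih]
        exact funext fun x => opL_const P hrow 1 x
    rw [this]
  have hD1 : ipW π D (fun _ => 1) = 0 := by
    rw [hDh, hL1, hL1]; simp [hπ1]; norm_num
  have hDle : ipW π D h ≤ 1 / 2 := by
    have h1 : 0 ≤ ∑ x, π x * ((D x - (2 * h x - 1))^2 + (1 - (2 * h x - 1)^2)) := by
      refine Finset.sum_nonneg fun x _ => mul_nonneg (hπ0 x).le ?_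
      have := hitBefore_nonneg P hnn a b x
      have := hitBefore_le_one P hnn hrow a b x
      have : 0 ≤ h x * (1 - h x) := mul_nonneg (by assumption) (by simp only [hh]; linarith)
      nlinarith [sq_nonneg (D x - (2 * h x - 1))]
    have h2 : ∑ x, π x * ((D x - (2 * h x - 1))^2 + (1 - (2 * h x - 1)^2))
        = ipW π D D - 4 * ipW π D h + 2 * ipW π D (fun _ => 1) + ∑ x, π x := by
      unfold ipW
      rw [Finset.mul_sum, Finset.mul_sum, ← Finset.sum_sub_distrib, ← Finset.sum_add_distrib,
        ← Finset.sum_add_distrib]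
      exact Finset.sum_congr rfl fun x _ => by ring
    rw [h2, hD1, hπ1] at h1
    linarith
  rw [hDh] at hDle
  have hLh : (L^s) h a + (L^(s+1)) h a ≤ 3 / 2 := by
    simp only [hh] at hDle ⊢
    linarith
  have hN : visitsUpTo P a s = ∑ i ∈ Finset.range (s+1), (L ^ i) (Pi.single a 1) a := by
    unfold visitsUpTo
    exact Finset.sum_congr rfl fun t _ => visit_eq P a a t
  have hlast : 0 ≤ (L^s) (Pi.single a 1) a := by
    have := opL_pow_mono P hnn s (f := 0) (g := Pi.single a 1) (fun x => by
      rw [Pi.single_apply]; split_ifs <;> simp) a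
    simpa using this
  refine Real.tsum_le_of_sum_range_le (fun t => kVis_nonneg P hnn a b t a) fun n => ?_
  change sVis P a b n a ≤ _
  have b1 := sVis_bound P hnn hrow a b hab n s
  have b2 := sVis_bound P hnn hrow a b hab n (s+1)
  rw [← hL, ← hh] at b1 b2
  rw [← hN] at b2
  rw [Finset.sum_range_succ] at hN
  have hM := mul_le_mul_of_nonneg_left hLh (sVis_nonneg P hnn a b n a)
  linarith
end

section
/- For any finite irreducible Markov chain there exists a universal constant c > 0 such that for the state x achieving t_cov = E_x[τ_cov], one has P_x(τ_cov > t_cov/2) ≥ c. -/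
open scoped BigOperators

/-- `P_x(τ_cov > t)`: the chain started at `x` has not visited every state by time `t`. -/
noncomputable def coverTail {V : Type*} [Fintype V] (P : V → V → ℝ) (x : V) (t : ℕ) : ℝ :=
  pathSum P x t (fun w => ¬ ∀ v : V, ∃ i, w i = v)

/-- `E_x[τ_cov]`, the expected cover time started from `x`. -/
noncomputable def expCov {V : Type*} [Fintype V] (P : V → V → ℝ) (x : V) : ℝ :=
  ∑' t : ℕ, coverTail P x t

/-- `t_cov = max_x E_x[τ_cov]`. -/
noncomputable def tcov {V : Type*} [Fintype V] [Nonempty V] (P : V → V → ℝ) : ℝ :=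
  ⨆ x : V, expCov P x

open Classical in
/-- Probability, starting at `x` with `S` already visited, that cover fails by time `t`. -/
noncomputable def covF {V : Type*} [Fintype V] (P : V → V → ℝ) : ℕ → Set V → V → ℝ
  | 0, S, x => if insert x S = Set.univ then 0 else 1
  | t+1, S, x => ∑ y, P x y * covF P t (insert x S) y

theorem pathSum_succ_cov {V : Type*} [Fintype V] (P : V → V → ℝ) (x : V) (t : ℕ)
    (A : (Fin (t+1+1) → V) → Prop) :
    pathSum P x (t+1) A = ∑ y, P x y * pathSum P y t (fun w => A (Fin.cons x w)) := by
  classical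
  unfold pathSum
  rw [← (Fin.consEquiv (fun _ : Fin (t+1+1) => V)).sum_comp, Fintype.sum_prod_type]
  rw [Finset.sum_eq_single x]
  · simp only [Finset.mul_sum]
    rw [Finset.sum_comm]
    refine Finset.sum_congr rfl fun w _ => ?_
    rw [Finset.sum_eq_single (w 0)]
    · simp only [Fin.consEquiv_apply, Fin.cons_zero, true_and]
      have e : (Fin.consEquiv (fun _ : Fin (t+1+1) => V)) (x, w) = (Fin.cons x w : Fin (t+1+1) → V) := rfl
      rw [e]
      by_cases hA : A (Fin.cons x w)
      · rw [if_pos hA, if_pos hA, Fin.prod_univ_succ]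
        simp [← Fin.succ_castSucc]
      · rw [if_neg hA, if_neg hA, mul_zero]
    · intro b _ hb
      rw [if_neg (fun h => hb h.1.symm), mul_zero]
    · simp
  · intro b _ hb
    refine Finset.sum_eq_zero fun w _ => ?_
    rw [if_neg]
    intro h
    exact hb (by simpa using h.1)
  · simp

theorem pathSum_eq_covF {V : Type*} [Fintype V] (P : V → V → ℝ) (t : ℕ) :
    ∀ (S : Set V) (x : V),
    pathSum P x t (fun w => ¬ ∀ v : V, v ∈ S ∨ ∃ i, w i = v) = covF P t S x := by
  classical
  induction t with
  | zero =>
    intro S x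
    unfold pathSum covF
    rw [Finset.sum_eq_single (fun _ => x)]
    · have : (∀ v : V, v ∈ S ∨ ∃ i : Fin (0+1), x = v) ↔ insert x S = Set.univ := by
        rw [Set.eq_univ_iff_forall]
        refine forall_congr' fun v => ?_
        simp only [Set.mem_insert_iff, exists_const]
        rw [or_comm, eq_comm]
      by_cases h : insert x S = Set.univ
      · rw [if_pos h, if_neg]; intro h'; exact h'.2 (this.2 h)
      · rw [if_neg h, if_pos]
        · simp
        · exact ⟨rfl, fun h' => h (this.1 h')⟩
    · intro w _ hw
      rw [if_neg]
      intro h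
      apply hw
      funext i
      rw [← h.1]
      congr 1
      exact Subsingleton.elim (α := Fin 1) _ _
    · simp
  | succ t ih =>
    intro S x
    rw [pathSum_succ_cov, covF]
    refine Finset.sum_congr rfl fun y _ => ?_
    rw [← ih]
    congr 2
    funext w
    simp only [Fin.exists_fin_succ, Fin.cons_zero, Fin.cons_succ, Set.mem_insert_iff, eq_iff_iff]
    refine not_congr (forall_congr' fun v => ?_)
    rw [eq_comm (a := x)]
    tauto

theorem coverTail_eq_covF {V : Type*} [Fintype V] (P : V → V → ℝ) (x : V) (t : ℕ) :
    coverTail P x t = covF P t ∅ x := by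
  rw [← pathSum_eq_covF]
  simp [coverTail]

section
variable {V : Type*} [Fintype V] (P : V → V → ℝ) (h0 : ∀ x y, 0 ≤ P x y)
  (h1 : ∀ x, ∑ y, P x y = 1)

theorem covF_univ (t : ℕ) (S : Set V) (x : V) (h : insert x S = Set.univ) :
    covF P t S x = 0 := by
  induction t generalizing S x with
  | zero => simp [covF, h]
  | succ t ih =>
    rw [covF]
    refine Finset.sum_eq_zero fun y _ => ?_
    rw [ih _ _ (by rw [h]; simp), mul_zero]

theorem covF_nonneg (h0 : ∀ x y, 0 ≤ P x y) (t : ℕ) (S : Set V) (x : V) : 0 ≤ covF P t S x := by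
  induction t generalizing S x with
  | zero => rw [covF]; split_ifs <;> norm_num
  | succ t ih =>
    rw [covF]
    exact Finset.sum_nonneg fun y _ => mul_nonneg (h0 _ _) (ih _ _)

theorem covF_le_one (h0 : ∀ x y, 0 ≤ P x y) (h1 : ∀ x, ∑ y, P x y = 1)
    (t : ℕ) (S : Set V) (x : V) : covF P t S x ≤ 1 := by
  induction t generalizing S x with
  | zero => rw [covF]; split_ifs <;> norm_num
  | succ t ih =>
    rw [covF, ← h1 x]
    exact Finset.sum_le_sum fun y _ => mul_le_of_le_one_right (h0 _ _) (ih _ _)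

theorem covF_anti_set (h0 : ∀ x y, 0 ≤ P x y) (t : ℕ) (S T : Set V) (hST : S ⊆ T) (x : V) :
    covF P t T x ≤ covF P t S x := by
  induction t generalizing S T x with
  | zero =>
    by_cases h : insert x T = Set.univ
    · rw [covF_univ P 0 T x h]; exact covF_nonneg P h0 _ _ _
    · have h' : insert x S ≠ Set.univ := fun h' => h (by
        rw [Set.eq_univ_iff_forall] at h' ⊢
        exact fun v => Set.insert_subset_insert hST (h' v))
      simp [covF, h, h']
  | succ t ih =>
    rw [covF, covF]
    exact Finset.sum_le_sum fun y _ => mul_le_mul_of_nonneg_left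
      (ih _ _ (Set.insert_subset_insert hST) _) (h0 _ _)

theorem covF_markov (h0 : ∀ x y, 0 ≤ P x y) (U : Finset ℕ) (c : ℝ)
    (hc : ∀ y, ∑ u ∈ U, covF P u ∅ y ≤ c) (s : ℕ) (S : Set V) (x : V) :
    ∑ u ∈ U, covF P (s+u) S x ≤ c * covF P s S x := by
  induction s generalizing S x with
  | zero =>
    by_cases h : insert x S = Set.univ
    · simp [covF_univ P _ S x h]
    · have : covF P 0 S x = 1 := by simp [covF, h]
      rw [this, mul_one]
      refine le_trans (Finset.sum_le_sum fun u _ => ?_) (hc x)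
      rw [zero_add]
      exact covF_anti_set P h0 _ _ _ (Set.empty_subset _) _
  | succ s ih =>
    have : ∀ u, s + 1 + u = (s + u) + 1 := by intro u; omega
    simp only [this, covF]
    rw [Finset.sum_comm, Finset.mul_sum]
    refine Finset.sum_le_sum fun y _ => ?_
    rw [← Finset.mul_sum, mul_left_comm]
    exact mul_le_mul_of_nonneg_left (ih _ _) (h0 _ _)

theorem covF_add_le (h0 : ∀ x y, 0 ≤ P x y) (N : ℕ) (r : ℝ)
    (hr : ∀ y, covF P N ∅ y ≤ r) (s : ℕ) (S : Set V) (x : V) :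
    covF P (s+N) S x ≤ r * covF P s S x := by
  simpa using covF_markov P h0 {N} r (by simpa using hr) s S x

theorem covF_anti (h0 : ∀ x y, 0 ≤ P x y) (h1 : ∀ x, ∑ y, P x y = 1)
    (S : Set V) (x : V) : Antitone (fun t => covF P t S x) := by
  refine antitone_nat_of_succ_le fun t => ?_
  simpa using covF_add_le P h0 1 1 (fun y => covF_le_one P h0 h1 _ _ _) t S x

theorem covF_step (h0 : ∀ x y, 0 ≤ P x y) (h1 : ∀ x, ∑ y, P x y = 1)
    (t : ℕ) (S : Set V) (x y : V) (hxy : 0 < P x y) (h : covF P t (insert x S) y < 1) :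
    covF P (t+1) S x < 1 := by
  rw [covF, ← h1 x]
  refine Finset.sum_lt_sum (fun y _ => mul_le_of_le_one_right (h0 _ _) (covF_le_one P h0 h1 _ _ _))
    ⟨y, Finset.mem_univ _, mul_lt_of_lt_one_right hxy h⟩

theorem covF_path [DecidableEq V] (h0 : ∀ x y, 0 ≤ P x y) (h1 : ∀ x, ∑ y, P x y = 1)
    (S0 : Set V) (v : V) (hv : ∀ S, S0 ⊆ S → ∃ t, covF P t S v < 1) (n : ℕ) (x : V)
    (hn : 0 < (Matrix.of P ^ n) x v) (S : Set V) (hS : S0 ⊆ S) : ∃ t, covF P t S x < 1 := by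
  induction n generalizing x S with
  | zero =>
    have : x = v := by
      by_contra h
      simp [Matrix.one_apply, h] at hn
    subst this
    exact hv S hS
  | succ n ih =>
    rw [pow_succ', Matrix.mul_apply] at hn
    obtain ⟨y, _, hy⟩ := Finset.exists_lt_of_sum_lt (s := Finset.univ) (f := fun _ : V => (0:ℝ))
      (by simpa using hn)
    replace hy : 0 < P x y * (Matrix.of P ^ n) y v := hy
    have hP : 0 < P x y := lt_of_le_of_ne (h0 x y) (fun h => by rw [← h] at hy; simp at hy)
    obtain ⟨t, ht⟩ := ih y (pos_of_mul_pos_right hy (h0 _ _)) (insert x S)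
      (hS.trans (Set.subset_insert _ _))
    exact ⟨t+1, covF_step P h0 h1 t S x y hP ht⟩

theorem covF_lt_one [DecidableEq V] (h0 : ∀ x y, 0 ≤ P x y) (h1 : ∀ x, ∑ y, P x y = 1)
    (hirr : ∀ x y, ∃ n : ℕ, 0 < (Matrix.of P ^ n) x y) (k : ℕ) :
    ∀ (S : Set V), Sᶜ.ncard ≤ k → ∀ x, ∃ t, covF P t S x < 1 := by
  induction k with
  | zero =>
    intro S hS x
    refine ⟨0, ?_⟩
    rw [covF_univ]
    · norm_num
    · have : Sᶜ = ∅ := (Set.ncard_eq_zero (Set.toFinite _)).1 (by omega)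
      rw [Set.compl_empty_iff] at this
      simp [this]
  | succ k ih =>
    intro S hS x
    by_cases hU : S = Set.univ
    · refine ⟨0, ?_⟩
      rw [covF_univ]
      · norm_num
      · simp [hU]
    · obtain ⟨v, hv⟩ := (Set.ne_univ_iff_exists_notMem S).1 hU
      obtain ⟨n, hn⟩ := hirr x v
      refine covF_path P h0 h1 S v (fun S' hS' => ?_) n x hn S subset_rfl
      obtain ⟨y, _, hy⟩ := Finset.exists_lt_of_sum_lt (s := Finset.univ) (f := fun _ : V => (0:ℝ))
        (g := fun y => P v y) (by simp [h1])
      have hlt : (insert v S')ᶜ.ncard < Sᶜ.ncard := by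
        refine Set.ncard_lt_ncard ?_ (Set.toFinite _)
        refine ⟨fun z hz hzS => hz (Or.inr (hS' hzS)), fun h => ?_⟩
        exact h hv (Or.inl rfl)
      obtain ⟨t, ht⟩ := ih (insert v S') (by omega) y
      exact ⟨t+1, covF_step P h0 h1 t S' v y hy ht⟩

theorem covF_summable [DecidableEq V] [Nonempty V] (h0 : ∀ x y, 0 ≤ P x y)
    (h1 : ∀ x, ∑ y, P x y = 1)
    (hirr : ∀ x y, ∃ n : ℕ, 0 < (Matrix.of P ^ n) x y) (x : V) :
    Summable (fun t => covF P t ∅ x) := by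
  choose T hT using fun y => covF_lt_one P h0 h1 hirr _ ∅ le_rfl y
  obtain ⟨N, hN⟩ : ∃ N, ∀ y, T y ≤ N := ⟨∑ y, T y, fun y =>
    Finset.single_le_sum (f := T) (fun _ _ => Nat.zero_le _) (Finset.mem_univ y)⟩
  have hlt : ∀ y, covF P N ∅ y < 1 := fun y => (covF_anti P h0 h1 ∅ y (hN y)).trans_lt (hT y)
  obtain ⟨z, hz⟩ := Finite.exists_max (fun y => covF P N ∅ y)
  set r := covF P N ∅ z with hr
  have hr1 : r < 1 := hlt z
  refine summable_of_sum_range_le (c := N / (1 - r)) (fun t => covF_nonneg P h0 _ _ _) fun n => ?_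
  rw [le_div_iff₀ (by linarith)]
  have e1 : ∑ t ∈ Finset.range n, covF P t ∅ x ≤ ∑ t ∈ Finset.range (N + n), covF P t ∅ x :=
    Finset.sum_le_sum_of_subset_of_nonneg (Finset.range_mono (by omega))
      (fun _ _ _ => covF_nonneg P h0 _ _ _)
  rw [Finset.sum_range_add] at e1
  have e2 : ∑ t ∈ Finset.range N, covF P t ∅ x ≤ N := by
    refine (Finset.sum_le_sum fun t _ => covF_le_one P h0 h1 t ∅ x).trans (by simp)
  have e3 : ∑ t ∈ Finset.range n, covF P (N + t) ∅ x
      ≤ r * ∑ t ∈ Finset.range n, covF P t ∅ x := by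
    rw [Finset.mul_sum]
    refine Finset.sum_le_sum fun t _ => ?_
    rw [add_comm]
    exact covF_add_le P h0 N r hz t ∅ x
  linarith

end

/-- There is a universal constant `c > 0` such that for any finite
irreducible chain (on at least two states), if `x` achieves `t_cov = E_x[τ_cov]`, then
`P_x(τ_cov > t_cov/2) ≥ c`. -/
theorem coverTail_at_half :
    ∃ c : ℝ, 0 < c ∧
      ∀ (V : Type) [Fintype V] [DecidableEq V] [Nonempty V] (P : V → V → ℝ),
        (∀ x y, 0 ≤ P x y) → (∀ x, ∑ y, P x y = 1) →
        (∀ x y, ∃ n : ℕ, 0 < (Matrix.of P ^ n) x y) →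
        1 < Fintype.card V →
        ∀ x : V, expCov P x = tcov P →
          c ≤ coverTail P x ⌊tcov P / 2⌋₊ := by
  refine ⟨1/2, by norm_num, ?_⟩
  intro V _ _ _ P h0 h1 hirr hcard x hx
  have hs := covF_summable P h0 h1 hirr
  have hE : ∀ y, expCov P y = ∑' t, covF P t ∅ y := fun y => by
    simp [expCov, coverTail_eq_covF]
  have hle : ∀ y, expCov P y ≤ tcov P := fun y => le_ciSup (Set.finite_range _).bddAbove y
  have hF0 : covF P 0 ∅ x = 1 := by
    rw [covF, if_neg]
    intro h
    obtain ⟨y, hy⟩ := Fintype.exists_ne_of_one_lt_card hcard x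
    have := Set.mem_univ y
    rw [← h] at this
    simp [hy] at this
  have hT1 : 1 ≤ tcov P := by
    rw [← hx, hE, ← hF0]
    exact (hs x).le_tsum 0 (fun _ _ => covF_nonneg P h0 _ _ _)
  rw [coverTail_eq_covF]
  set s := ⌊tcov P / 2⌋₊ with hsdef
  have hsle : (s : ℝ) ≤ tcov P / 2 := Nat.floor_le (by linarith)
  have e1 := (hs x).sum_add_tsum_nat_add s
  rw [← hE, hx] at e1
  have e2 : ∑ t ∈ Finset.range s, covF P t ∅ x ≤ s := by
    refine (Finset.sum_le_sum fun t _ => covF_le_one P h0 h1 t ∅ x).trans (by simp)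
  have e3 : ∑' u, covF P (u + s) ∅ x ≤ tcov P * covF P s ∅ x := by
    refine Real.tsum_le_of_sum_range_le (fun _ => covF_nonneg P h0 _ _ _) fun n => ?_
    simp only [add_comm _ s]
    refine covF_markov P h0 _ _ (fun y => ?_) s ∅ x
    refine ((hs y).sum_le_tsum _ (fun _ _ => covF_nonneg P h0 _ _ _)).trans ?_
    rw [← hE]; exact hle y
  have : tcov P * (1/2) ≤ tcov P * covF P s ∅ x := by linarith
  exact le_of_mul_le_mul_left this (by linarith)
end

section
/- Let η^λ and η^μ (for 0 < λ < μ ≤ 1/2) be the Gaussian free fields on V ∪ {∂} with boundary ∂ associated to the networks with weights w^λ and w^μ, where w^λ(x,∂) = λπ(x)/(1+λ) and w^λ(x,y) = (1-λ)P(x,y)π(x)/(1+λ). Then E[max_v η^μ_v] ≤ 3·E[max_v η^λ_v]. -/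
open scoped BigOperators
open MeasureTheory

open MeasureTheory

/-- Effective resistance in the weighted network with edge weights `w`, via the
Dirichlet variational principle. -/
noncomputable def effRes {S : Type*} [Fintype S] (w : S → S → ℝ) (a b : S) : ℝ :=
  (sInf ((fun f : S → ℝ => (1 / 2) * ∑ x, ∑ y, w x y * (f x - f y) ^ 2) ''
    {f | f a = 1 ∧ f b = 0}))⁻¹

/-- The weights of the auxiliary network on `V ∪ {∂}` (with `∂ = none`):
`w^λ(x,∂) = λπ(x)/(1+λ)` and `w^λ(x,y) = (1-λ)P(x,y)π(x)/(1+λ)`. -/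
noncomputable def wAux {V : Type*} (P : V → V → ℝ) (π : V → ℝ) (lam : ℝ) :
    Option V → Option V → ℝ
  | some x, some y => (1 - lam) * P x y * π x / (1 + lam)
  | some x, none => lam * π x / (1 + lam)
  | none, some y => lam * π y / (1 + lam)
  | none, none => 0


lemma gaux_memLp {Ω : Type*} [MeasurableSpace Ω] {μ : Measure Ω} {f : Ω → ℝ}
    (hf : Measurable f) {s : NNReal}
    (h : Measure.map f μ = ProbabilityTheory.gaussianReal 0 s) : MemLp f 2 μ := by
  have h2 : MemLp id 2 (Measure.map f μ) := by
    rw [h]; exact ProbabilityTheory.memLp_id_gaussianReal 2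
  exact (memLp_map_measure_iff (by fun_prop) hf.aemeasurable).1 h2

lemma gaux_sq {Ω : Type*} [MeasurableSpace Ω] {μ : Measure Ω} {f : Ω → ℝ}
    (hf : Measurable f) {s : NNReal}
    (h : Measure.map f μ = ProbabilityTheory.gaussianReal 0 s) :
    ∫ ω, f ω ^ 2 ∂μ = s := by
  have h1 := ProbabilityTheory.variance_fun_id_gaussianReal (μ := 0) (v := s)
  rw [ProbabilityTheory.variance_eq_integral measurable_id'.aemeasurable,
    ProbabilityTheory.integral_id_gaussianReal, ← h,
    integral_map hf.aemeasurable (by fun_prop)] at h1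
  simpa using h1

lemma gaux_exp {Ω : Type*} [MeasurableSpace Ω] {μ : Measure Ω} {f : Ω → ℝ}
    (hf : Measurable f) {s : NNReal}
    (h : Measure.map f μ = ProbabilityTheory.gaussianReal 0 s) :
    ∫ ω, Complex.exp (f ω * Complex.I) ∂μ
      = Complex.exp (-((∫ ω, f ω ^ 2 ∂μ : ℝ) : ℂ) / 2) := by
  rw [gaux_sq hf h]
  have h1 := ProbabilityTheory.charFun_gaussianReal (μ := 0) (v := s) 1
  rw [← h, charFun_apply_real, integral_map hf.aemeasurable (by fun_prop)] at h1
  simp only [Complex.ofReal_one, one_mul] at h1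
  rw [h1]
  congr 1
  push_cast
  ring

lemma gaux_charFun {ι : Type*} [Fintype ι] {Ω : Type*} [MeasurableSpace Ω] {μ : Measure Ω}
    {X : ι → Ω → ℝ} (hX : ∀ i, Measurable (X i))
    (hg : ∀ c : ι → ℝ, ∃ s : NNReal,
      Measure.map (fun ω => ∑ z, c z * X z ω) μ = ProbabilityTheory.gaussianReal 0 s)
    (t : EuclideanSpace ℝ ι) :
    charFun (Measure.map (fun ω => WithLp.toLp 2 (fun i => X i ω)) μ) t
      = Complex.exp (-((∫ ω, (∑ z, t z * X z ω) ^ 2 ∂μ : ℝ) : ℂ) / 2) := by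
  obtain ⟨s, hs⟩ := hg t
  rw [charFun_apply, integral_map (by fun_prop) (by fun_prop), ← gaux_exp (by fun_prop) hs]
  simp [PiLp.inner_apply]

lemma gaux_quad {ι : Type*} [Fintype ι] {Ω : Type*} [MeasurableSpace Ω] {μ : Measure Ω}
    {X : ι → Ω → ℝ} (hX : ∀ i, MemLp (X i) 2 μ) (c : ι → ℝ) :
    ∫ ω, (∑ z, c z * X z ω) ^ 2 ∂μ = ∑ i, ∑ j, c i * c j * ∫ ω, X i ω * X j ω ∂μ := by
  have hij : ∀ i j, Integrable (fun ω => c i * c j * (X i ω * X j ω)) μ := fun i j =>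
    ((hX i).integrable_mul (hX j)).const_mul _
  have : ∀ ω, (∑ z, c z * X z ω) ^ 2 = ∑ i, ∑ j, c i * c j * (X i ω * X j ω) := by
    intro ω
    rw [sq, Finset.sum_mul_sum]
    refine Finset.sum_congr rfl fun i _ => Finset.sum_congr rfl fun j _ => by ring
  simp_rw [this]
  rw [integral_finsetSum _ (fun i _ => integrable_finsetSum _ fun j _ => hij i j)]
  refine Finset.sum_congr rfl fun i _ => ?_
  rw [integral_finsetSum _ fun j _ => hij i j]
  refine Finset.sum_congr rfl fun j _ => ?_
  rw [integral_const_mul]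

lemma gaux_memLp_coord {ι : Type*} [Fintype ι] [DecidableEq ι] {Ω : Type*} [MeasurableSpace Ω]
    {μ : Measure Ω}
    {X : ι → Ω → ℝ} (hX : ∀ i, Measurable (X i))
    (hg : ∀ c : ι → ℝ, ∃ s : NNReal,
      Measure.map (fun ω => ∑ z, c z * X z ω) μ = ProbabilityTheory.gaussianReal 0 s) (i : ι) :
    MemLp (X i) 2 μ := by
  obtain ⟨s, hs⟩ := hg (Pi.single i 1)
  have := gaux_memLp (by fun_prop) hs
  simpa [Pi.single_apply] using this

lemma gaux_iSup_int {ι : Type*} [Fintype ι] [Nonempty ι] {Ω : Type*} [MeasurableSpace Ω]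
    {μ : Measure Ω} {X : ι → Ω → ℝ} (hX : ∀ i, Integrable (X i) μ) 
    (hm : ∀ i, Measurable (X i)) :
    Integrable (fun ω => ⨆ i, X i ω) μ := by
  refine Integrable.mono' (g := fun ω => ∑ i, |X i ω|)
    (integrable_finsetSum _ fun i _ => (hX i).abs)
    (Measurable.iSup hm).aestronglyMeasurable (Filter.Eventually.of_forall fun ω => ?_)
  rw [Real.norm_eq_abs]
  obtain ⟨i, hi⟩ := exists_eq_ciSup_of_finite (f := fun i => X i ω)
  rw [← hi]
  exact Finset.single_le_sum (f := fun i => |X i ω|) (fun i _ => abs_nonneg _) (Finset.mem_univ i)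

lemma gaux_cmp {ι : Type*} [Fintype ι] [DecidableEq ι] [Nonempty ι]
    {Ω₁ Ω₂ : Type*} [MeasurableSpace Ω₁] [MeasurableSpace Ω₂]
    (μ₁ : Measure Ω₁) [IsProbabilityMeasure μ₁]
    (μ₂ : Measure Ω₂) [IsProbabilityMeasure μ₂]
    (Y : ι → Ω₁ → ℝ) (X : ι → Ω₂ → ℝ)
    (hY : ∀ z, Measurable (Y z)) (hX : ∀ z, Measurable (X z))
    (gY : ∀ c : ι → ℝ, ∃ s : NNReal,
      Measure.map (fun ω => ∑ z, c z * Y z ω) μ₁ = ProbabilityTheory.gaussianReal 0 s)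
    (gX : ∀ c : ι → ℝ, ∃ s : NNReal,
      Measure.map (fun ω => ∑ z, c z * X z ω) μ₂ = ProbabilityTheory.gaussianReal 0 s)
    (hle : ∀ c : ι → ℝ, ∫ ω, (∑ z, c z * X z ω) ^ 2 ∂μ₂ ≤ ∫ ω, (∑ z, c z * Y z ω) ^ 2 ∂μ₁) :
    ∫ ω, (⨆ z, X z ω) ∂μ₂ ≤ ∫ ω, (⨆ z, Y z ω) ∂μ₁ := by
  have mX := gaux_memLp_coord hX gX
  have mY := gaux_memLp_coord hY gY
  let S : Matrix ι ι ℝ := Matrix.of fun i j =>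
    (∫ ω, Y i ω * Y j ω ∂μ₁) - ∫ ω, X i ω * X j ω ∂μ₂
  have hSq : ∀ c : ι → ℝ, c ⬝ᵥ S.mulVec c
      = ∫ ω, (∑ z, c z * Y z ω) ^ 2 ∂μ₁ - ∫ ω, (∑ z, c z * X z ω) ^ 2 ∂μ₂ := by
    intro c
    rw [gaux_quad mX, gaux_quad mY, ← Finset.sum_sub_distrib]
    simp only [dotProduct, Matrix.mulVec, S, Matrix.of_apply, Finset.mul_sum]
    refine Finset.sum_congr rfl fun i _ => ?_
    rw [← Finset.sum_sub_distrib]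
    refine Finset.sum_congr rfl fun j _ => by ring
  have hS : S.PosSemidef := by
    refine Matrix.PosSemidef.of_dotProduct_mulVec_nonneg ?_ fun c => ?_
    · ext i j
      simp [S, mul_comm]
    · rw [star_trivial, hSq]
      linarith [hle c]
  let ν := ProbabilityTheory.multivariateGaussian (0 : EuclideanSpace ℝ ι) S
  let toX : Ω₂ → EuclideanSpace ℝ ι := fun ω => WithLp.toLp 2 (fun i => X i ω)
  let toY : Ω₁ → EuclideanSpace ℝ ι := fun ω => WithLp.toLp 2 (fun i => Y i ω)
  have htX : Measurable toX := by fun_prop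
  have htY : Measurable toY := by fun_prop
  have := Measure.isProbabilityMeasure_map (μ := μ₂) htX.aemeasurable
  have := Measure.isProbabilityMeasure_map (μ := μ₁) htY.aemeasurable
  have key : Measure.map toY μ₁ = (Measure.map toX μ₂).conv ν := by
    apply Measure.ext_of_charFun
    ext t
    rw [charFun_conv, gaux_charFun hX gX, gaux_charFun hY gY,
      ProbabilityTheory.charFun_multivariateGaussian hS, hSq, ← Complex.exp_add]
    congr 1
    push_cast
    simp only [inner_zero_right]
    push_cast
    ring
  let M : EuclideanSpace ℝ ι → ℝ := fun x => ⨆ i, x i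
  have hM : Measurable M := Measurable.iSup fun i => by fun_prop
  have intX : ∀ i, Integrable (X i) μ₂ := fun i => (mX i).integrable (by norm_num)
  have intY : ∀ i, Integrable (Y i) μ₁ := fun i => (mY i).integrable (by norm_num)
  have e1 : ∫ ω, (⨆ z, Y z ω) ∂μ₁ = ∫ x, M x ∂(Measure.map toY μ₁) := by
    rw [integral_map htY.aemeasurable hM.aestronglyMeasurable]
  have iM : Integrable M (Measure.map toY μ₁) := by
    rw [integrable_map_measure hM.aestronglyMeasurable htY.aemeasurable]
    exact gaux_iSup_int intY hY
  have iMX : Integrable M (Measure.map toX μ₂) := by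
    rw [integrable_map_measure hM.aestronglyMeasurable htX.aemeasurable]
    exact gaux_iSup_int intX hX
  have e2 : ∫ ω, (⨆ z, X z ω) ∂μ₂ = ∫ x, M x ∂(Measure.map toX μ₂) := by
    rw [integral_map htX.aemeasurable hM.aestronglyMeasurable]
  have iν : Integrable (fun x : EuclideanSpace ℝ ι => x) ν :=
    ProbabilityTheory.IsGaussian.integrable_fun_id
  have iνc : ∀ i, Integrable (fun x : EuclideanSpace ℝ ι => x i) ν := fun i =>
    (EuclideanSpace.proj (𝕜 := ℝ) i).integrable_comp iν
  have zν : ∀ i, ∫ x : EuclideanSpace ℝ ι, x i ∂ν = 0 := fun i => by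
    have := (EuclideanSpace.proj i : EuclideanSpace ℝ ι →L[ℝ] ℝ).integral_comp_comm iν
    rw [ProbabilityTheory.integral_id_multivariateGaussian] at this
    simpa using this
  rw [e1, e2, key, integral_conv (key ▸ iM)]
  have iMc : ∀ x : EuclideanSpace ℝ ι, Integrable (fun y => M (x + y)) ν := fun x => by
    refine gaux_iSup_int (X := fun i (y : EuclideanSpace ℝ ι) => (x + y) i) (fun i => ?_)
      (fun i => by fun_prop)
    simpa using (integrable_const (x i)).add (iνc i)
  refine integral_mono iMX ?_ fun x => ?_
  · rw [key] at iM
    exact ((integrable_map_measure hM.aestronglyMeasurable (by fun_prop)).1 iM).integral_prod_left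
  · refine ciSup_le fun i => ?_
    have h3 : ∫ y, (x i + y i) ∂ν = x i := by
      rw [integral_add (integrable_const _) (iνc i), zν]
      simp
    rw [← h3]
    refine integral_mono ((integrable_const _).add (iνc i)) (iMc x) fun y => ?_
    exact le_ciSup (f := fun i => (x + y) i) (Set.finite_range _).bddAbove i

noncomputable def dext {V : Type*} (g : V → ℝ) : Option V → ℝ := fun z => z.elim 0 g

noncomputable def dB {S : Type*} [Fintype S] (w : S → S → ℝ) (f g : S → ℝ) : ℝ :=
  (1 / 2) * ∑ x, ∑ y, w x y * ((f x - f y) * (g x - g y))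

noncomputable def dA {V : Type*} [Fintype V] (w : Option V → Option V → ℝ) :
    (V → ℝ) →ₗ[ℝ] (V → ℝ) where
  toFun g x := ∑ y, w (some x) y * (dext g (some x) - dext g y)
  map_add' f g := by
    ext x
    simp only [Pi.add_apply, ← Finset.sum_add_distrib]
    refine Finset.sum_congr rfl fun y _ => ?_
    cases y <;> simp [dext] <;> ring
  map_smul' c g := by
    ext x
    simp only [Pi.smul_apply, smul_eq_mul, Finset.mul_sum, RingHom.id_apply]
    refine Finset.sum_congr rfl fun y _ => ?_
    cases y <;> simp [dext] <;> ring

lemma dB_comm {S : Type*} [Fintype S] (w : S → S → ℝ) (f g : S → ℝ) : dB w f g = dB w g f := by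
  simp only [dB, mul_comm (f _ - f _)]

lemma dB_expand {S : Type*} [Fintype S] (w : S → S → ℝ) (f g : S → ℝ) (a b : ℝ) :
    dB w (fun x => a * f x - b * g x) (fun x => a * f x - b * g x)
      = a ^ 2 * dB w f f - 2 * a * b * dB w f g + b ^ 2 * dB w g g := by
  simp only [dB, Finset.mul_sum, ← Finset.sum_sub_distrib, ← Finset.sum_add_distrib]
  refine Finset.sum_congr rfl fun x _ => Finset.sum_congr rfl fun y _ => by ring

lemma dB_nonneg {S : Type*} [Fintype S] (w : S → S → ℝ) (hw : ∀ x y, 0 ≤ w x y) (f : S → ℝ) :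
    0 ≤ dB w f f := by
  refine mul_nonneg (by norm_num) (Finset.sum_nonneg fun x _ => Finset.sum_nonneg fun y _ => ?_)
  exact mul_nonneg (hw x y) (mul_self_nonneg _)

lemma dB_eq {V : Type*} [Fintype V] (w : Option V → Option V → ℝ)
    (hs : ∀ x y, w x y = w y x) (f g : V → ℝ) :
    dB w (dext g) (dext f) = ∑ x, dA w g x * f x := by
  have h1 : ∑ x, ∑ y, w x y * ((dext g x - dext g y) * (dext f x - dext f y))
      = 2 * ∑ x, ∑ y, w x y * (dext g x - dext g y) * dext f x := by
    have h2 : ∑ x, ∑ y, w x y * (dext g x - dext g y) * dext f x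
        = ∑ x, ∑ y, - (w x y * (dext g x - dext g y) * dext f y) := by
      rw [Finset.sum_comm]
      refine Finset.sum_congr rfl fun x _ => Finset.sum_congr rfl fun y _ => ?_
      rw [hs y x]; ring
    rw [two_mul]
    nth_rewrite 2 [h2]
    simp only [← Finset.sum_add_distrib]
    refine Finset.sum_congr rfl fun x _ => Finset.sum_congr rfl fun y _ => by ring
  rw [dB, h1, ← mul_assoc]
  rw [show (1 / 2 * 2 : ℝ) = 1 by norm_num, one_mul, Fintype.sum_option]
  have : dext f none = 0 := rfl
  simp only [this, mul_zero, Finset.sum_const_zero, zero_add, ← Finset.sum_mul]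
  rfl

lemma dB_pos {V : Type*} [Fintype V] (w : Option V → Option V → ℝ)
    (hw : ∀ x y, 0 ≤ w x y) (hp : ∀ x, 0 < w (some x) none) (g : V → ℝ)
    (h : dB w (dext g) (dext g) = 0) : g = 0 := by
  have hn : ∀ x y, 0 ≤ w x y * ((dext g x - dext g y) * (dext g x - dext g y)) :=
    fun x y => mul_nonneg (hw x y) (mul_self_nonneg _)
  have h1 : ∑ x, ∑ y, w x y * ((dext g x - dext g y) * (dext g x - dext g y)) = 0 := by
    rw [dB] at h; linarith
  rw [Finset.sum_eq_zero_iff_of_nonneg fun x _ => Finset.sum_nonneg fun y _ => hn x y] at h1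
  ext x
  have h2 := h1 (some x) (Finset.mem_univ _)
  rw [Finset.sum_eq_zero_iff_of_nonneg fun y _ => hn _ y] at h2
  have h3 := h2 none (Finset.mem_univ _)
  simpa [dext, (hp x).ne'] using h3

lemma dU_exists {V : Type*} [Fintype V] (w : Option V → Option V → ℝ)
    (hs : ∀ x y, w x y = w y x)
    (hw : ∀ x y, 0 ≤ w x y) (hp : ∀ x, 0 < w (some x) none) :
    ∃ U : (V → ℝ) →ₗ[ℝ] (V → ℝ), ∀ c g, dB w (dext (U c)) (dext g) = ∑ x, c x * g x := by
  have inj : Function.Injective (dA w) := by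
    rw [← LinearMap.ker_eq_bot, LinearMap.ker_eq_bot']
    intro g hg
    apply dB_pos w hw hp
    rw [dB_eq w hs, hg]; simp
  let e := LinearEquiv.ofInjectiveEndo (dA w) inj
  refine ⟨e.symm.toLinearMap, fun c g => ?_⟩
  rw [dB_eq w hs]
  have : dA w (e.symm c) = c := e.apply_symm_apply c
  simp [this]

/-- indicator vector -/
noncomputable def dd {V : Type*} [DecidableEq V] : Option V → V → ℝ
  | none => 0
  | some x => Pi.single x 1

lemma dd_dot {V : Type*} [Fintype V] [DecidableEq V] (z : Option V) (g : V → ℝ) :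
    ∑ x, dd z x * g x = dext g z := by
  cases z <;> simp [dd, dext, Pi.single_apply]

lemma effRes_eq {V : Type*} [Fintype V] [DecidableEq V] (w : Option V → Option V → ℝ)
    (hw : ∀ x y, 0 ≤ w x y) 
    (U : (V → ℝ) →ₗ[ℝ] (V → ℝ))
    (hU : ∀ c g, dB w (dext (U c)) (dext g) = ∑ x, c x * g x) (a b : Option V) :
    effRes w a b = ∑ x, (dd a - dd b) x * U (dd a - dd b) x := by
  by_cases hab : a = b
  · subst hab
    have : {f : Option V → ℝ | f a = 1 ∧ f a = 0} = ∅ := by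
      ext f; simp only [Set.mem_ofPred_eq, Set.mem_empty_iff_false, iff_false]
      rintro ⟨h1, h2⟩; rw [h1] at h2; norm_num at h2
    simp [effRes, this]
  set c : V → ℝ := dd a - dd b with hc
  have hdot : ∀ g : V → ℝ, ∑ x, c x * g x = dext g a - dext g b := fun g => by
    simp only [hc, Pi.sub_apply, sub_mul, Finset.sum_sub_distrib, dd_dot]
  set K := ∑ x, c x * U c x with hK
  have hKB : dB w (dext (U c)) (dext (U c)) = K := hU c _
  -- test function with c·g = 1
  have key : ∀ f : Option V → ℝ, f a = 1 → f b = 0 → ∀ t : ℝ, 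
      0 ≤ dB w f f - 2 * t + t ^ 2 * K := by
    intro f h1 h2 t
    let g : V → ℝ := fun x => f (some x) - f none
    have hg : ∀ z, dext g z = f z - f none := fun z => by cases z <;> simp [dext, g]
    have h3 : dB w f f = dB w (dext g) (dext g) := by simp [dB, hg]
    have h4 : dB w (dext g) (dext (U c)) = 1 := by
      rw [dB_comm, hU, hdot, hg, hg, h1, h2]; ring
    have h5 := dB_expand w (dext g) (dext (U c)) 1 t
    have h6 := dB_nonneg w hw (fun x => 1 * dext g x - t * dext (U c) x)
    rw [h5, h4, hKB] at h6
    rw [h3]; linarith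
  have hKpos : 0 < K := by
    have h0 : 0 ≤ K := hKB ▸ dB_nonneg w hw _
    refine lt_of_le_of_ne h0 fun h => ?_
    have h1 := key (Pi.single a 1) (by simp) (by simp [Ne.symm hab])
      (dB w (Pi.single a 1) (Pi.single a 1) / 2 + 1)
    rw [← h] at h1
    linarith
  have hUK : dext (U c) a - dext (U c) b = K := (hdot _).symm
  have hleast : IsLeast ((fun f : Option V → ℝ =>
      (1 / 2) * ∑ x, ∑ y, w x y * (f x - f y) ^ 2) '' {f | f a = 1 ∧ f b = 0}) K⁻¹ := by
    constructor
    · refine ⟨fun z => (dext (U c) z - dext (U c) b) / K, ⟨?_, by simp⟩, ?_⟩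
      · change (dext (U c) a - dext (U c) b) / K = 1
        rw [hUK, div_self hKpos.ne']
      · have : K⁻¹ = K⁻¹ ^ 2 * K := by field_simp
        rw [this]
        have h7 : K⁻¹ ^ 2 * K = K⁻¹ ^ 2 * dB w (dext (U c)) (dext (U c)) := by rw [hKB]
        rw [h7]
        simp only [dB, Finset.mul_sum]
        refine Finset.sum_congr rfl fun x _ => Finset.sum_congr rfl fun y _ => ?_
        field_simp
        ring
    · rintro _ ⟨f, ⟨h1, h2⟩, rfl⟩
      have h3 := key f h1 h2 K⁻¹
      have h4 : K⁻¹ ^ 2 * K = K⁻¹ := by field_simp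
      have h5 : dB w f f = (1 / 2) * ∑ x, ∑ y, w x y * (f x - f y) ^ 2 := by
        simp only [dB, sq]
      change K⁻¹ ≤ (1 / 2) * ∑ x, ∑ y, w x y * (f x - f y) ^ 2
      linarith
  rw [effRes, hleast.csInf_eq, inv_inv]

lemma var_eq {V : Type*} [Fintype V] [DecidableEq V] (w : Option V → Option V → ℝ)
    (hw : ∀ x y, 0 ≤ w x y) 
    (U : (V → ℝ) →ₗ[ℝ] (V → ℝ))
    (hU : ∀ c g, dB w (dext (U c)) (dext g) = ∑ x, c x * g x)
    {Ω : Type*} [MeasurableSpace Ω] {μ : Measure Ω}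
    {X : Option V → Ω → ℝ} (hX : ∀ i, MemLp (X i) 2 μ)
    (hbd : ∀ ω, X none ω = 0)
    (hvar : ∀ z z' : Option V, ∫ ω, (X z ω - X z' ω) ^ 2 ∂μ = effRes w z z')
    (c : Option V → ℝ) :
    ∫ ω, (∑ z, c z * X z ω) ^ 2 ∂μ
      = ∑ x, (∑ z, c z • dd z) x * U (∑ z, c z • dd z) x := by
  let F : (V → ℝ) → (V → ℝ) → ℝ := fun a b => ∑ x, a x * U b x
  have Fsymm : ∀ a b, F a b = F b a := fun a b => by
    simp only [F]; rw [← hU, ← hU, dB_comm]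
  have hcov : ∀ i j, ∫ ω, X i ω * X j ω ∂μ = F (dd i) (dd j) := by
    intro i j
    have h1 := hvar i j
    have h2 := hvar i none
    have h3 := hvar j none
    simp only [hbd, sub_zero] at h2 h3
    have d0 : (dd none : V → ℝ) = 0 := rfl
    rw [effRes_eq w hw U hU] at h1 h2 h3
    rw [d0, sub_zero] at h2 h3
    have h4 : ∫ ω, (X i ω - X j ω) ^ 2 ∂μ
        = ∫ ω, X i ω ^ 2 ∂μ + ∫ ω, X j ω ^ 2 ∂μ - 2 * ∫ ω, X i ω * X j ω ∂μ := by
      rw [← integral_const_mul, ← integral_add (hX i).integrable_sq (hX j).integrable_sq,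
        ← integral_sub (f := fun a => X i a ^ 2 + X j a ^ 2)
          (g := fun a => 2 * (X i a * X j a)) ((hX i).integrable_sq.add (hX j).integrable_sq)
          (((hX i).integrable_mul (hX j)).const_mul 2)]
      congr 1; ext ω; ring
    have h5 : ∑ x, (dd i - dd j) x * U (dd i - dd j) x
        = F (dd i) (dd i) + F (dd j) (dd j) - F (dd i) (dd j) - F (dd j) (dd i) := by
      simp only [F, ← Finset.sum_add_distrib, ← Finset.sum_sub_distrib, map_sub, Pi.sub_apply]
      refine Finset.sum_congr rfl fun x _ => by ring
    rw [Fsymm (dd j) (dd i)] at h5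
    simp only [F] at h5 ⊢
    linarith
  rw [gaux_quad hX]
  simp only [hcov, F, map_sum, map_smul, Finset.sum_apply, Pi.smul_apply, smul_eq_mul,
    Finset.sum_mul_sum]
  simp only [Finset.mul_sum]
  rw [Finset.sum_comm (s := (Finset.univ : Finset V))]
  refine Finset.sum_congr rfl fun i _ => ?_
  rw [Finset.sum_comm (s := (Finset.univ : Finset V))]
  refine Finset.sum_congr rfl fun j _ => Finset.sum_congr rfl fun x _ => by ring

lemma U_cmp {V : Type*} [Fintype V] (w w' : Option V → Option V → ℝ)
    (hw : ∀ x y, 0 ≤ w x y) (hle : ∀ x y, w x y ≤ 3 * w' x y)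
    (U U' : (V → ℝ) →ₗ[ℝ] (V → ℝ))
    (hU : ∀ c g, dB w (dext (U c)) (dext g) = ∑ x, c x * g x)
    (hU' : ∀ c g, dB w' (dext (U' c)) (dext g) = ∑ x, c x * g x) (c : V → ℝ) :
    ∑ x, c x * U' c x ≤ 3 * ∑ x, c x * U c x := by
  have h1 := dB_nonneg w hw (fun x => 3 * dext (U c) x - 1 * dext (U' c) x)
  rw [dB_expand, hU, hU] at h1
  have h2 : dB w (dext (U' c)) (dext (U' c)) ≤ 3 * dB w' (dext (U' c)) (dext (U' c)) := by
    simp only [dB, Finset.mul_sum]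
    refine Finset.sum_le_sum fun x _ => Finset.sum_le_sum fun y _ => ?_
    nlinarith [mul_le_mul_of_nonneg_right (hle x y) (mul_self_nonneg (dext (U' c) x - dext (U' c) y))]
  rw [hU'] at h2
  linarith

lemma wAux_symm {V : Type*} (P : V → V → ℝ) (π : V → ℝ)
    (hrev : ∀ x y, π x * P x y = π y * P y x) (l : ℝ) (x y : Option V) :
    wAux P π l x y = wAux P π l y x := by
  cases x <;> cases y <;> simp only [wAux]
  rename_i x y
  rw [mul_assoc, mul_assoc, mul_comm (P x y), hrev, mul_comm (π y)]

lemma wAux_nonneg {V : Type*} (P : V → V → ℝ) (π : V → ℝ) (hnn : ∀ x y, 0 ≤ P x y)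
    (hπ0 : ∀ x, 0 < π x) (l : ℝ) (h0 : 0 < l) (h1 : l ≤ 1 / 2) (x y : Option V) :
    0 ≤ wAux P π l x y := by
  have h2 : 0 ≤ 1 - l := by linarith
  cases x <;> cases y <;> simp only [wAux]
  · exact le_rfl
  · rename_i y; have := hπ0 y; positivity
  · rename_i y; have := hπ0 y; positivity
  · rename_i x y; have := hπ0 x; have := hnn x y; positivity

lemma wAux_le {V : Type*} (P : V → V → ℝ) (π : V → ℝ) (hnn : ∀ x y, 0 ≤ P x y)
    (hπ0 : ∀ x, 0 < π x) (l m : ℝ) (h0 : 0 < l) (hlm : l < m) (h1 : m ≤ 1 / 2) (x y : Option V) :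
    wAux P π l x y ≤ 3 * wAux P π m x y := by
  have e1 : l / (1 + l) ≤ 3 * (m / (1 + m)) := by
    rw [← mul_div_assoc, div_le_div_iff₀ (by linarith) (by linarith)]
    nlinarith
  have e2 : (1 - l) / (1 + l) ≤ 3 * ((1 - m) / (1 + m)) := by
    rw [← mul_div_assoc, div_le_div_iff₀ (by linarith) (by linarith)]
    nlinarith
  have e3 : ∀ x, l * π x / (1 + l) ≤ 3 * (m * π x / (1 + m)) := fun x => by
    have := mul_le_mul_of_nonneg_right e1 (hπ0 x).le
    calc _ = l / (1 + l) * π x := by ring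
      _ ≤ _ := this
      _ = _ := by ring
  cases x <;> cases y <;> simp only [wAux]
  · norm_num
  · exact e3 _
  · exact e3 _
  · rename_i x y
    have := mul_le_mul_of_nonneg_right e2 (mul_nonneg (hnn x y) (hπ0 x).le)
    calc _ = (1 - l) / (1 + l) * (P x y * π x) := by ring
      _ ≤ _ := this
      _ = _ := by ring

/-- For `0 < λ < μ ≤ 1/2`, the Gaussian free fields `η^λ, η^μ` on
`V ∪ {∂}` with boundary `∂` associated to the networks `w^λ, w^μ` satisfy
`E[max_v η^μ_v] ≤ 3·E[max_v η^λ_v]`. -/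
theorem gff_max_comparison {V : Type*} [Fintype V] [DecidableEq V]
    (P : V → V → ℝ) (π : V → ℝ)
    (hnn : ∀ x y, 0 ≤ P x y) (hrow : ∀ x, ∑ y, P x y = 1)
    (hirr : ∀ x y, ∃ n : ℕ, 0 < (Matrix.of P ^ n) x y)
    (hπ0 : ∀ x, 0 < π x) (hπ1 : ∑ x, π x = 1)
    (hrev : ∀ x y, π x * P x y = π y * P y x)
    (lam mu : ℝ) (h0 : 0 < lam) (hlm : lam < mu) (hmu : mu ≤ 1 / 2)
    {Ω₁ Ω₂ : Type*} [MeasurableSpace Ω₁] [MeasurableSpace Ω₂]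
    (μ₁ : Measure Ω₁) [IsProbabilityMeasure μ₁]
    (μ₂ : Measure Ω₂) [IsProbabilityMeasure μ₂]
    (ηl : Option V → Ω₁ → ℝ) (ηm : Option V → Ω₂ → ℝ)
    (hmeas₁ : ∀ z, Measurable (ηl z)) (hmeas₂ : ∀ z, Measurable (ηm z))
    (hgauss₁ : ∀ c : Option V → ℝ, ∃ s : NNReal,
      Measure.map (fun ω => ∑ z, c z * ηl z ω) μ₁ = ProbabilityTheory.gaussianReal 0 s)
    (hgauss₂ : ∀ c : Option V → ℝ, ∃ s : NNReal,
      Measure.map (fun ω => ∑ z, c z * ηm z ω) μ₂ = ProbabilityTheory.gaussianReal 0 s)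
    (hbd₁ : ∀ ω, ηl none ω = 0) (hbd₂ : ∀ ω, ηm none ω = 0)
    (hvar₁ : ∀ z z' : Option V,
      ∫ ω, (ηl z ω - ηl z' ω) ^ 2 ∂μ₁ = effRes (wAux P π lam) z z')
    (hvar₂ : ∀ z z' : Option V,
      ∫ ω, (ηm z ω - ηm z' ω) ^ 2 ∂μ₂ = effRes (wAux P π mu) z z') :
    (∫ ω, (⨆ z : Option V, ηm z ω) ∂μ₂) ≤ 3 * ∫ ω, (⨆ z : Option V, ηl z ω) ∂μ₁ := by
  have hl2 : lam ≤ 1 / 2 := by linarith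
  have hm0 : 0 < mu := by linarith
  have hwl := wAux_nonneg P π hnn hπ0 lam h0 hl2
  have hwm := wAux_nonneg P π hnn hπ0 mu hm0 hmu
  obtain ⟨U, hU⟩ := dU_exists (wAux P π lam) (wAux_symm P π hrev lam) hwl
    (fun x => by have := hπ0 x; simp only [wAux]; positivity)
  obtain ⟨U', hU'⟩ := dU_exists (wAux P π mu) (wAux_symm P π hrev mu) hwm
    (fun x => by have := hπ0 x; simp only [wAux]; positivity)
  have v1 := var_eq _ hwl U hU (gaux_memLp_coord hmeas₁ hgauss₁) hbd₁ hvar₁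
  have v2 := var_eq _ hwm U' hU' (gaux_memLp_coord hmeas₂ hgauss₂) hbd₂ hvar₂
  have hc := gaux_cmp μ₁ μ₂ (fun z ω => 3 * ηl z ω) ηm (fun z => (hmeas₁ z).const_mul 3) hmeas₂
    (fun c => by
      obtain ⟨s, hs⟩ := hgauss₁ (fun z => c z * 3)
      exact ⟨s, by simpa only [mul_assoc] using hs⟩) hgauss₂ (fun c => by
      have h3 : ∀ ω, (∑ z, c z * (3 * ηl z ω)) ^ 2 = 9 * (∑ z, c z * ηl z ω) ^ 2 := fun ω => by
        have : ∑ z, c z * (3 * ηl z ω) = 3 * ∑ z, c z * ηl z ω := by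
          rw [Finset.mul_sum]; exact Finset.sum_congr rfl fun z _ => by ring
        rw [this]; ring
      simp only [h3]
      rw [integral_const_mul]
      have h4 : 0 ≤ ∫ ω, (∑ z, c z * ηl z ω) ^ 2 ∂μ₁ := integral_nonneg fun ω => sq_nonneg _
      have h5 := U_cmp _ _ hwl (wAux_le P π hnn hπ0 lam mu h0 hlm hmu) U U' hU hU'
        (∑ z, c z • dd z)
      rw [← v1, ← v2] at h5
      linarith)
  refine hc.trans_eq ?_
  rw [← integral_const_mul]
  congr 1
  ext ω
  rw [Real.mul_iSup_of_nonneg (by norm_num)]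
end
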